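/- arXiv:1310.6391 — 2 statements merged into one kernel-verified Lean document; each statement's English description precedes it below -/
import Mathlib

section
/- Let μ₁, μ₂ ∈ ℝ, σ₁, σ₂ > 0, and α > 0 with α ≠ 1, and let N(μ, σ²) denote the Gaussian measure on ℝ with mean μ and variance σ². Set σ_α² := α σ₂² + (1−α) σ₁². If σ_α² > 0 then R_α(N(μ₁,σ₁²) ‖ N(μ₂,σ₂²)) = (1/α) log(σ₂/σ₁) + (1/(2α(α−1))) log(σ₂²/σ_α²) + (μ₁−μ₂)²/(2 σ_α²), and if σ_α² ≤ 0 then R_α(N(μ₁,σ₁²) ‖ N(μ₂,σ₂²)) = ∞. -/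
open MeasureTheory Real ProbabilityTheory
open scoped Classical ENNReal NNReal

/-- Rényi divergence of order `α > 0`, `α ≠ 1`, of `ν` from `θ`, defined using densities with
respect to the dominating measure `ν + θ`. -/
noncomputable def renyiDivAux {S : Type*} [MeasurableSpace S] (α : ℝ)
    (ν θ : Measure S) : EReal :=
  if 1 < α ∧ ¬ ν ≪ θ then ⊤
  else ((α * (α - 1))⁻¹ : ℝ) *
    ENNReal.log (∫⁻ x in {x | 0 < ν.rnDeriv (ν + θ) x ∧ 0 < θ.rnDeriv (ν + θ) x},
      (ν.rnDeriv (ν + θ) x / θ.rnDeriv (ν + θ) x) ^ α ∂θ)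

/-- Rényi divergence of order `α ∈ ℝ \ {0, 1}`, extended to negative orders by
`R_α(ν‖θ) = R_{1-α}(θ‖ν)`. -/
noncomputable def renyiDiv {S : Type*} [MeasurableSpace S] (α : ℝ)
    (ν θ : Measure S) : EReal :=
  if α < 0 then renyiDivAux (1 - α) θ ν else renyiDivAux α ν θ

/-- For finite measures with everywhere positive densities `f` and `g` with respect to `κ`, the
Rényi divergence is given by the integral of `g * (f / g) ^ α` against `κ`. -/
theorem renyiDivAux_withDensity {S : Type*} [MeasurableSpace S] (α : ℝ)
    (κ : Measure S) [SigmaFinite κ] (f g : S → ℝ≥0∞) (hf : Measurable f) (hg : Measurable g)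
    (hf0 : ∀ x, f x ≠ 0) (hg0 : ∀ x, g x ≠ 0)
    [IsFiniteMeasure (κ.withDensity f)] [IsFiniteMeasure (κ.withDensity g)] :
    renyiDivAux α (κ.withDensity f) (κ.withDensity g) =
      ((α * (α - 1))⁻¹ : ℝ) * ENNReal.log (∫⁻ x, g x * (f x / g x) ^ α ∂κ) := by
  set ν := κ.withDensity f with hν
  set θ := κ.withDensity g with hθ
  have hνκ : ν ≪ κ := withDensity_absolutelyContinuous κ f
  have hθκ : θ ≪ κ := withDensity_absolutelyContinuous κ g
  have hκθ : κ ≪ θ := withDensity_absolutelyContinuous' hg.aemeasurable (ae_of_all _ hg0)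
  have hνs : ν ≪ ν + θ := Measure.absolutelyContinuous_of_le (Measure.le_add_right le_rfl)
  have hθs : θ ≪ ν + θ := Measure.absolutelyContinuous_of_le (Measure.le_add_left le_rfl)
  have key : ∀ᵐ x ∂κ, (0 < ν.rnDeriv (ν + θ) x ∧ 0 < θ.rnDeriv (ν + θ) x) ∧
      ν.rnDeriv (ν + θ) x / θ.rnDeriv (ν + θ) x = f x / g x := by
    filter_upwards [Measure.rnDeriv_mul_rnDeriv (κ := κ) hνs,
      Measure.rnDeriv_mul_rnDeriv (κ := κ) hθs, Measure.rnDeriv_lt_top (ν + θ) κ,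
      Measure.rnDeriv_withDensity κ hf, Measure.rnDeriv_withDensity κ hg] with x h1 h2 h3 h4 h5
    rw [← hν] at h4
    rw [← hθ] at h5
    rw [h4, Pi.mul_apply] at h1
    rw [h5, Pi.mul_apply] at h2
    have hf' := hf0 x
    have hg' := hg0 x
    rw [← h1] at hf' ⊢
    rw [← h2] at hg' ⊢
    refine ⟨⟨pos_iff_ne_zero.2 (left_ne_zero_of_mul hf'),
      pos_iff_ne_zero.2 (left_ne_zero_of_mul hg')⟩, ?_⟩
    rw [ENNReal.mul_div_mul_right _ _ (right_ne_zero_of_mul hf') h3.ne]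
  have keyθ : ∀ᵐ x ∂θ, (0 < ν.rnDeriv (ν + θ) x ∧ 0 < θ.rnDeriv (ν + θ) x) ∧
      ν.rnDeriv (ν + θ) x / θ.rnDeriv (ν + θ) x = f x / g x := hθκ.ae_le key
  have hpos : ∀ᵐ x ∂θ, x ∈ {x | 0 < ν.rnDeriv (ν + θ) x ∧ 0 < θ.rnDeriv (ν + θ) x} :=
    keyθ.mono fun x hx ↦ hx.1
  have hmeas : Measurable fun x ↦ (f x / g x) ^ α := (hf.div hg).pow_const α
  rw [renyiDivAux, if_neg (fun h ↦ h.2 (hνκ.trans hκθ)),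
    Measure.restrict_eq_self_of_ae_mem hpos,
    lintegral_congr_ae (keyθ.mono fun x hx ↦ by rw [hx.2] :
      _ =ᵐ[θ] fun x ↦ (f x / g x) ^ α),
    hθ, lintegral_withDensity_eq_lintegral_mul κ hg hmeas]
  rfl

theorem gaussianPDFReal_sq_eq_exp (μ σ x : ℝ) (hσ : 0 < σ) :
    gaussianPDFReal μ (σ ^ 2).toNNReal x =
      exp (-(log √(2 * π) + log σ) - (x - μ) ^ 2 / (2 * σ ^ 2)) := by
  have h2 : 0 < √(2 * π) := by positivity
  rw [gaussianPDFReal, Real.coe_toNNReal _ (sq_nonneg σ), Real.sqrt_mul (by positivity),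
    Real.sqrt_sq hσ.le, sub_eq_add_neg (-(log √(2 * π) + log σ)), Real.exp_add,
    Real.exp_neg (log √(2 * π) + log σ), Real.exp_add, Real.exp_log h2, Real.exp_log hσ, neg_div]

theorem ofReal_exp_mul_div_rpow (a b α : ℝ) :
    ENNReal.ofReal (exp b) * (ENNReal.ofReal (exp a) / ENNReal.ofReal (exp b)) ^ α =
      ENNReal.ofReal (exp (α * a + (1 - α) * b)) := by
  rw [← ENNReal.ofReal_div_of_pos (exp_pos b), ← Real.exp_sub,
    ENNReal.ofReal_rpow_of_pos (exp_pos _), ← Real.exp_mul,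
    ← ENNReal.ofReal_mul (exp_pos _).le, ← Real.exp_add]
  ring_nf

theorem renyiDiv_gaussianReal_eq_log_lintegral (μ₁ μ₂ σ₁ σ₂ α : ℝ) (hσ₁ : 0 < σ₁)
    (hσ₂ : 0 < σ₂) (hα : 0 < α) :
    renyiDiv α (gaussianReal μ₁ (σ₁ ^ 2).toNNReal) (gaussianReal μ₂ (σ₂ ^ 2).toNNReal) =
      ((α * (α - 1))⁻¹ : ℝ) * ENNReal.log (∫⁻ x, ENNReal.ofReal
        (exp (α * (-(log √(2 * π) + log σ₁) - (x - μ₁) ^ 2 / (2 * σ₁ ^ 2)) +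
          (1 - α) * (-(log √(2 * π) + log σ₂) - (x - μ₂) ^ 2 / (2 * σ₂ ^ 2))))) := by
  have h₁ : (σ₁ ^ 2).toNNReal ≠ 0 := (Real.toNNReal_pos.2 (by positivity)).ne'
  have h₂ : (σ₂ ^ 2).toNNReal ≠ 0 := (Real.toNNReal_pos.2 (by positivity)).ne'
  have hp₁ := gaussianReal_of_var_ne_zero μ₁ h₁
  have hp₂ := gaussianReal_of_var_ne_zero μ₂ h₂
  have : IsFiniteMeasure (volume.withDensity (gaussianPDF μ₁ (σ₁ ^ 2).toNNReal)) :=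
    hp₁ ▸ inferInstance
  have : IsFiniteMeasure (volume.withDensity (gaussianPDF μ₂ (σ₂ ^ 2).toNNReal)) :=
    hp₂ ▸ inferInstance
  rw [renyiDiv, if_neg hα.le.not_gt, hp₁, hp₂,
    renyiDivAux_withDensity α volume _ _ (measurable_gaussianPDF _ _) (measurable_gaussianPDF _ _)
      (fun x ↦ (gaussianPDF_pos _ h₁ x).ne') (fun x ↦ (gaussianPDF_pos _ h₂ x).ne')]
  simp_rw [gaussianPDF, gaussianPDFReal_sq_eq_exp _ _ _ hσ₁, gaussianPDFReal_sq_eq_exp _ _ _ hσ₂,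
    ofReal_exp_mul_div_rpow]

theorem lintegral_exp_quadratic_eq_top (a b c : ℝ) (ha : 0 ≤ a) :
    ∫⁻ x : ℝ, ENNReal.ofReal (exp (a * x ^ 2 + b * x + c)) = ∞ := by
  obtain ⟨s, hs, hvol, hb⟩ : ∃ s : Set ℝ, MeasurableSet s ∧ volume s = ∞ ∧
      ∀ x ∈ s, 0 ≤ b * x := by
    rcases le_total 0 b with h | h
    · exact ⟨Set.Ici 0, measurableSet_Ici, Real.volume_Ici, fun x hx ↦ mul_nonneg h hx⟩
    · exact ⟨Set.Iic 0, measurableSet_Iic, Real.volume_Iic,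
        fun x hx ↦ mul_nonneg_of_nonpos_of_nonpos h hx⟩
  refine top_unique ?_
  calc ∞ = ∫⁻ _ in s, ENNReal.ofReal (exp c) := by
        rw [setLIntegral_const, hvol,
          ENNReal.mul_top (ENNReal.ofReal_pos.2 (exp_pos c)).ne']
    _ ≤ ∫⁻ x in s, ENNReal.ofReal (exp (a * x ^ 2 + b * x + c)) := by
        refine setLIntegral_mono' hs fun x hx ↦ ENNReal.ofReal_le_ofReal (exp_le_exp.2 ?_)
        have := mul_nonneg ha (sq_nonneg x)
        linarith [hb x hx]
    _ ≤ _ := setLIntegral_le_lintegral _ _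

/-- **Rényi divergence between Gaussian distributions.** For `σ₁, σ₂ > 0`, `α > 0`, `α ≠ 1`, and
`σ_α² := α σ₂² + (1-α) σ₁²`: if `σ_α² > 0` then
`R_α(N(μ₁,σ₁²)‖N(μ₂,σ₂²)) = (1/α) log(σ₂/σ₁) + (1/(2α(α-1))) log(σ₂²/σ_α²)
  + (μ₁-μ₂)²/(2σ_α²)`, and otherwise it is `+∞`. -/
theorem renyiDiv_gaussian (μ₁ μ₂ σ₁ σ₂ α : ℝ) (hσ₁ : 0 < σ₁) (hσ₂ : 0 < σ₂)
    (hα : 0 < α) (hα1 : α ≠ 1) :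
    (0 < α * σ₂ ^ 2 + (1 - α) * σ₁ ^ 2 →
      renyiDiv α (gaussianReal μ₁ (σ₁ ^ 2).toNNReal) (gaussianReal μ₂ (σ₂ ^ 2).toNNReal)
        = ((α⁻¹ * Real.log (σ₂ / σ₁)
            + (2 * α * (α - 1))⁻¹ * Real.log (σ₂ ^ 2 / (α * σ₂ ^ 2 + (1 - α) * σ₁ ^ 2))
            + (μ₁ - μ₂) ^ 2 / (2 * (α * σ₂ ^ 2 + (1 - α) * σ₁ ^ 2)) : ℝ) : EReal)) ∧
    (α * σ₂ ^ 2 + (1 - α) * σ₁ ^ 2 ≤ 0 →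
      renyiDiv α (gaussianReal μ₁ (σ₁ ^ 2).toNNReal) (gaussianReal μ₂ (σ₂ ^ 2).toNNReal)
        = ⊤) := by
  rw [renyiDiv_gaussianReal_eq_log_lintegral μ₁ μ₂ σ₁ σ₂ α hσ₁ hσ₂ hα]
  have hα1' : α - 1 ≠ 0 := sub_ne_zero.2 hα1
  constructor
  · intro hs
    obtain ⟨s, hs_def⟩ : ∃ s, s = α * σ₂ ^ 2 + (1 - α) * σ₁ ^ 2 := ⟨_, rfl⟩
    rw [← hs_def] at hs ⊢
    set L : ℝ := (α - 1) * (log σ₂ - log σ₁) + (log σ₂ - log s / 2)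
      + α * (α - 1) * (μ₁ - μ₂) ^ 2 / (2 * s) with hL
    set τ : ℝ := σ₁ * σ₂ / √s with hτ_def
    have hτ : 0 < τ := by positivity
    have hτ_sq : τ ^ 2 = σ₁ ^ 2 * σ₂ ^ 2 / s := by
      rw [hτ_def, div_pow, Real.sq_sqrt hs.le, mul_pow]
    have hτ_log : log τ = log σ₁ + log σ₂ - log s / 2 := by
      rw [hτ_def, Real.log_div (by positivity) (by positivity),
        Real.log_mul hσ₁.ne' hσ₂.ne', Real.log_sqrt hs.le]
    set m : ℝ := (α * σ₂ ^ 2 * μ₁ + (1 - α) * σ₁ ^ 2 * μ₂) / s with hm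
    have hint : ∀ x : ℝ, ENNReal.ofReal
        (exp (α * (-(log √(2 * π) + log σ₁) - (x - μ₁) ^ 2 / (2 * σ₁ ^ 2)) +
          (1 - α) * (-(log √(2 * π) + log σ₂) - (x - μ₂) ^ 2 / (2 * σ₂ ^ 2)))) =
        ENNReal.ofReal (exp L) * gaussianPDF m (τ ^ 2).toNNReal x := by
      intro x
      rw [gaussianPDF, gaussianPDFReal_sq_eq_exp _ _ _ hτ, ← ENNReal.ofReal_mul (exp_pos _).le,
        ← Real.exp_add]
      congr 2
      have hsq : α * ((x - μ₁) ^ 2 / (2 * σ₁ ^ 2)) + (1 - α) * ((x - μ₂) ^ 2 / (2 * σ₂ ^ 2)) =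
          (x - m) ^ 2 / (2 * τ ^ 2) - α * (α - 1) * (μ₁ - μ₂) ^ 2 / (2 * s) := by
        rw [hτ_sq, hm]
        field_simp
        rw [hs_def]
        ring
      rw [hτ_log, hL]
      linear_combination -hsq
    simp_rw [hint]
    rw [lintegral_const_mul _ (measurable_gaussianPDF _ _),
      lintegral_gaussianPDF_eq_one _ (Real.toNNReal_pos.2 (by positivity)).ne', mul_one,
      ENNReal.log_ofReal_of_pos (exp_pos L), Real.log_exp, ← EReal.coe_mul,
      Real.log_div hσ₂.ne' hσ₁.ne', Real.log_div (by positivity) hs.ne', Real.log_pow, hL]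
    congr 1
    field_simp
    push_cast
    ring
  · intro hs
    have hα_gt : 1 < α := by
      by_contra! h
      have := mul_nonneg (sub_nonneg.2 h) (sq_nonneg σ₁)
      have : 0 < α * σ₂ ^ 2 := by positivity
      linarith
    have hint : ∀ x : ℝ,
        α * (-(log √(2 * π) + log σ₁) - (x - μ₁) ^ 2 / (2 * σ₁ ^ 2)) +
          (1 - α) * (-(log √(2 * π) + log σ₂) - (x - μ₂) ^ 2 / (2 * σ₂ ^ 2)) =
        (-(α * σ₂ ^ 2 + (1 - α) * σ₁ ^ 2) / (2 * σ₁ ^ 2 * σ₂ ^ 2)) * x ^ 2 +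
          (α * μ₁ / σ₁ ^ 2 + (1 - α) * μ₂ / σ₂ ^ 2) * x +
          (α * (-(log √(2 * π) + log σ₁) - μ₁ ^ 2 / (2 * σ₁ ^ 2)) +
            (1 - α) * (-(log √(2 * π) + log σ₂) - μ₂ ^ 2 / (2 * σ₂ ^ 2))) := by
      intro x
      field_simp
      ring
    simp_rw [hint]
    rw [lintegral_exp_quadratic_eq_top _ _ _ (div_nonneg (neg_nonneg.2 hs) (by positivity)),
      ENNReal.log_top]
    exact EReal.coe_mul_top_of_pos (inv_pos.2 (mul_pos hα (sub_pos.2 hα_gt)))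
end

section
/- Fix n ≥ 1, α > 1, and c ∈ ℝ. Let θ₁ be a probability measure on ℝ, let θ = θ₁^{⊗n} be the n-fold product measure on ℝⁿ, and let X₁, …, X_n denote the coordinate maps. Then (1/(n(α−1))) log E_θ[e^{(α−1) c (X₁ + ⋯ + X_n)}] ≤ R_α(θ₁ ‖ N(0,1)) + α c² / 2, where N(0,1) is the standard Gaussian measure on ℝ and the inequality is interpreted in [−∞, +∞]. -/
open MeasureTheory Real ProbabilityTheory
open scoped Classical ENNReal NNReal

namespace MeasureTheory

/-- A change of measure from `ν ≪ θ` to `θ`, through the densities of `ν` and `θ` with respect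
to `ν + θ`. -/
theorem lintegral_eq_setLIntegral_rnDeriv_div_mul {S : Type*} [MeasurableSpace S]
    {ν θ : Measure S} [IsFiniteMeasure ν] [IsFiniteMeasure θ] (hνθ : ν ≪ θ)
    {g : S → ℝ≥0∞} (hg : Measurable g) :
    ∫⁻ x, g x ∂ν = ∫⁻ x in {x | 0 < ν.rnDeriv (ν + θ) x ∧ 0 < θ.rnDeriv (ν + θ) x},
      (ν.rnDeriv (ν + θ) x / θ.rnDeriv (ν + θ) x) * g x ∂θ := by
  set p := ν.rnDeriv (ν + θ)
  set q := θ.rnDeriv (ν + θ)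
  have hν : ν ≪ ν + θ := Measure.AbsolutelyContinuous.rfl.add_right θ
  have hθ : θ ≪ ν + θ := by
    rw [add_comm]
    exact Measure.AbsolutelyContinuous.rfl.add_right ν
  have hp : Measurable p := Measure.measurable_rnDeriv _ _
  have hq : Measurable q := Measure.measurable_rnDeriv _ _
  set A : Set S := {x | 0 < p x ∧ 0 < q x}
  have hA : MeasurableSet A :=
    (measurableSet_lt measurable_const hp).inter (measurableSet_lt measurable_const hq)
  have hAν : ∀ᵐ x ∂ν, x ∈ A := by
    filter_upwards [Measure.rnDeriv_pos hν, hνθ.ae_le (Measure.rnDeriv_pos hθ)] with x h1 h2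
    exact ⟨h1, h2⟩
  calc ∫⁻ x, g x ∂ν = ∫⁻ x, A.indicator g x ∂ν := by
        refine lintegral_congr_ae ?_
        filter_upwards [hAν] with x hx
        rw [Set.indicator_of_mem hx]
    _ = ∫⁻ x, p x * A.indicator g x ∂(ν + θ) :=
        (lintegral_rnDeriv_mul hν (hg.indicator hA).aemeasurable).symm
    _ = ∫⁻ x, q x * A.indicator (fun x ↦ p x / q x * g x) x ∂(ν + θ) := by
        refine lintegral_congr_ae ?_
        filter_upwards [Measure.rnDeriv_lt_top θ (ν + θ)] with x hx
        by_cases hxA : x ∈ A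
        · rw [Set.indicator_of_mem hxA, Set.indicator_of_mem hxA, ← mul_assoc,
            ENNReal.mul_div_cancel hxA.2.ne' hx.ne]
        · simp [Set.indicator_of_notMem hxA]
    _ = ∫⁻ x, A.indicator (fun x ↦ p x / q x * g x) x ∂θ :=
        lintegral_rnDeriv_mul hθ (((hp.div hq).mul hg).indicator hA).aemeasurable
    _ = ∫⁻ x in A, p x / q x * g x ∂θ := lintegral_indicator hA _

/-- Hölder's inequality for a change of measure from `ν ≪ θ` to `θ`. -/
theorem lintegral_le_lintegral_rnDeriv_div_rpow_mul {S : Type*} [MeasurableSpace S]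
    {ν θ : Measure S} [IsFiniteMeasure ν] [IsFiniteMeasure θ] (hνθ : ν ≪ θ)
    {α β : ℝ} (hαβ : α.HolderConjugate β) {g : S → ℝ≥0∞} (hg : Measurable g) :
    ∫⁻ x, g x ∂ν ≤
      (∫⁻ x in {x | 0 < ν.rnDeriv (ν + θ) x ∧ 0 < θ.rnDeriv (ν + θ) x},
        (ν.rnDeriv (ν + θ) x / θ.rnDeriv (ν + θ) x) ^ α ∂θ) ^ (1 / α) *
      (∫⁻ x, g x ^ β ∂θ) ^ (1 / β) := by
  rw [lintegral_eq_setLIntegral_rnDeriv_div_mul hνθ hg]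
  refine (ENNReal.lintegral_mul_le_Lp_mul_Lq _ hαβ
    ((Measure.measurable_rnDeriv _ _).div (Measure.measurable_rnDeriv _ _)).aemeasurable
    hg.aemeasurable).trans ?_
  refine mul_le_mul_right (ENNReal.rpow_le_rpow ?_ (one_div_nonneg.2 hαβ.symm.nonneg)) _
  exact setLIntegral_le_lintegral _ _

/-- The exponential moment of a sum of i.i.d. variables is a power of that of one of them. -/
theorem lintegral_exp_mul_sum_pi {ι : Type*} [Fintype ι] (μ : Measure ℝ) [IsProbabilityMeasure μ]
    (t : ℝ) :
    ∫⁻ ω, ENNReal.ofReal (exp (t * ∑ i, ω i)) ∂(Measure.pi fun _ : ι ↦ μ) =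
      (∫⁻ x, ENNReal.ofReal (exp (t * x)) ∂μ) ^ Fintype.card ι := by
  have hexp : Measurable fun x : ℝ ↦ ENNReal.ofReal (exp (t * x)) := by fun_prop
  have hprod (ω : ι → ℝ) : ENNReal.ofReal (exp (t * ∑ i, ω i)) =
      ∏ i, ENNReal.ofReal (exp (t * ω i)) := by
    rw [Finset.mul_sum, exp_sum, ENNReal.ofReal_prod_of_nonneg fun i _ ↦ (exp_pos _).le]
  simp_rw [hprod]
  rw [lintegral_prod_eq_prod_lintegral_of_indepFun Finset.univ
    (fun i (ω : ι → ℝ) ↦ ENNReal.ofReal (exp (t * ω i)))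
    (iIndepFun_pi (μ := fun _ : ι ↦ μ) (X := fun _ x ↦ ENNReal.ofReal (exp (t * x)))
      fun _ ↦ hexp.aemeasurable) fun i ↦ hexp.comp (measurable_pi_apply i)]
  simp_rw [fun i : ι ↦ (measurePreserving_eval (fun _ : ι ↦ μ) i).lintegral_comp hexp]
  simp

/-- The exponential moments of the standard Gaussian measure. -/
theorem lintegral_exp_mul_gaussianReal_zero_one (t : ℝ) :
    ∫⁻ x, ENNReal.ofReal (exp (t * x)) ∂(gaussianReal 0 1) = ENNReal.ofReal (exp (t ^ 2 / 2)) := by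
  rw [← ofReal_integral_eq_lintegral_ofReal (integrable_exp_mul_gaussianReal t)
    (ae_of_all _ fun x ↦ (exp_pos _).le)]
  congr 1
  simpa [mgf] using congrFun (mgf_id_gaussianReal (μ := 0) (v := 1)) t

end MeasureTheory

/-- **Robust bound for exponential moments of sums, with Gaussian nominal model.** For `α > 1`,
`c ∈ ℝ` and `θ = θ₁^⊗n` an `n`-fold product of a probability measure `θ₁` on `ℝ`,
`(1/(n(α-1))) log E_θ[e^{(α-1)c(X₁+⋯+Xₙ)}] ≤ R_α(θ₁‖N(0,1)) + αc²/2`, where the exponential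
moment is taken in `[0,∞]` and the inequality is interpreted in `[-∞,∞]`. -/
theorem renyi_gaussian_sum_bound (n : ℕ) (hn : 1 ≤ n) (α c : ℝ) (hα : 1 < α)
    (θ₁ : Measure ℝ) [IsProbabilityMeasure θ₁] :
    ((((n : ℝ) * (α - 1))⁻¹ : ℝ) : EReal) *
        ENNReal.log (∫⁻ ω, ENNReal.ofReal (Real.exp ((α - 1) * c * ∑ i, ω i))
          ∂(Measure.pi fun _ : Fin n => θ₁))
      ≤ renyiDiv α θ₁ (gaussianReal 0 1) + ((α * c ^ 2 / 2 : ℝ) : EReal) := by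
  have hn0 : (n : ℝ) ≠ 0 := by positivity
  have hα1 : 0 < α - 1 := sub_pos.2 hα
  have hα0 : 0 < α := one_pos.trans hα
  rw [renyiDiv, if_neg hα0.not_gt, renyiDivAux]
  split_ifs with h
  · rw [EReal.top_add_coe]
    exact le_top
  have hac : θ₁ ≪ gaussianReal 0 1 := by_contra fun hac ↦ h ⟨hα, hac⟩
  have hβ : α.HolderConjugate (α / (α - 1)) := Real.HolderConjugate.conjExponent hα
  have hmoment := lintegral_le_lintegral_rnDeriv_div_rpow_mul hac hβ
    (g := fun x ↦ ENNReal.ofReal (exp ((α - 1) * c * x))) (by fun_prop)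
  have hpow (x : ℝ) : ENNReal.ofReal (exp ((α - 1) * c * x)) ^ (α / (α - 1)) =
      ENNReal.ofReal (exp (α * c * x)) := by
    rw [ENNReal.ofReal_rpow_of_pos (exp_pos _), ← Real.exp_mul]
    congr 2
    field_simp
  simp_rw [hpow, lintegral_exp_mul_gaussianReal_zero_one] at hmoment
  rw [lintegral_exp_mul_sum_pi, Fintype.card_fin, ENNReal.log_pow, ← mul_assoc,
    ← EReal.coe_natCast, ← EReal.coe_mul]
  have hlog := ENNReal.log_le_log hmoment
  rw [ENNReal.log_mul_add, ENNReal.log_rpow, ENNReal.log_rpow,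
    ENNReal.log_ofReal_of_pos (exp_pos _), Real.log_exp, ← EReal.coe_mul] at hlog
  have hcoef : ((n : ℝ) * (α - 1))⁻¹ * n = (α - 1)⁻¹ := by field_simp
  have hinv : (0 : EReal) ≤ ((α - 1)⁻¹ : ℝ) := EReal.coe_nonneg.2 (inv_nonneg.2 hα1.le)
  rw [hcoef]
  refine (mul_le_mul_of_nonneg_left hlog hinv).trans_eq ?_
  rw [EReal.left_distrib_of_nonneg_of_ne_top hinv (EReal.coe_ne_top _), ← mul_assoc,
    ← EReal.coe_mul, ← EReal.coe_mul]
  congr 2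
  · congr 1
    field_simp
  · field_simp
end
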